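/- Let n ≥ 3, ν > n/2 − 1, 1 ≤ p < ∞, and set α = (n−1)/p. Define F on the tube T_{Λ_n} by F(z) = Q((z+ie)/i)^{−α} · (1 + Log Q((z+ie)/i))^{−1/p}, using principal branches of the complex power and logarithm; this is well defined and holomorphic since for every z ∈ T_{Λ_n} the number Q((z+ie)/i) lies in ℂ ∖ (−∞,0] and has modulus > 1. Let □ denote the wave operator □ = −(1/4)( ∂²/∂z₁² − Σ_{k=2}^n ∂²/∂z_k² ), acting via complex partial derivatives. Then: (i) ∫_{ℝ^n} |F(x+ie)|^p dx = ∞; and (ii) for every q with p·q_ν ≤ q < ∞, ∫_{Λ_n} ( ∫_{ℝ^n} |□F(x+iy)|^p dx )^{q/p} Q(y)^{(ν+q)−n/2} dy < ∞. -/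

import Mathlib

open MeasureTheory Complex Set
open scoped ENNReal NNReal

noncomputable section

def lorentzQ (n : ℕ) [NeZero n] (y : Fin n → ℝ) : ℝ :=
  y 0 ^ 2 - ∑ k ∈ Finset.univ.filter (fun k => k ≠ 0), y k ^ 2

def lorentzQC (n : ℕ) [NeZero n] (z : Fin n → ℂ) : ℂ :=
  z 0 ^ 2 - ∑ k ∈ Finset.univ.filter (fun k => k ≠ 0), z k ^ 2

def lightCone (n : ℕ) [NeZero n] : Set (Fin n → ℝ) :=
  {y | 0 < y 0 ∧ 0 < lorentzQ n y}

def tubePt (n : ℕ) (x y : Fin n → ℝ) : Fin n → ℂ :=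
  fun k => (x k : ℂ) + (y k : ℂ) * Complex.I

def inTube (n : ℕ) [NeZero n] (z : Fin n → ℂ) : Prop :=
  (fun k => (z k).im) ∈ lightCone n

def eVec (n : ℕ) [NeZero n] : Fin n → ℝ := fun k => if k = 0 then 1 else 0

def mixedNorm (n : ℕ) [NeZero n] (p q ν : ℝ) (F : (Fin n → ℂ) → ℂ) : ℝ≥0∞ :=
  (∫⁻ y in lightCone n,
      (∫⁻ x : Fin n → ℝ, (‖F (tubePt n x y)‖₊ : ℝ≥0∞) ^ p) ^ (q / p)
        * ENNReal.ofReal (lorentzQ n y ^ (ν - (n : ℝ) / 2))) ^ (1 / q)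

def bergmanIntegrand (n : ℕ) [NeZero n] (ν : ℝ) (F : (Fin n → ℂ) → ℂ) (z : Fin n → ℂ)
    (uv : (Fin n → ℝ) × (Fin n → ℝ)) : ℂ :=
  lorentzQC n (fun k => (z k - ((uv.1 k : ℂ) - (uv.2 k : ℂ) * Complex.I)) / Complex.I)
      ^ (((-(ν + (n : ℝ) / 2) : ℝ)) : ℂ)
    * F (tubePt n uv.1 uv.2)
    * ((lorentzQ n uv.2 ^ (ν - (n : ℝ) / 2) : ℝ) : ℂ)

def bergmanOp (n : ℕ) [NeZero n] (ν : ℝ) (F : (Fin n → ℂ) → ℂ) (z : Fin n → ℂ) : ℂ :=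
  ∫ uv in (univ ×ˢ lightCone n : Set ((Fin n → ℝ) × (Fin n → ℝ))),
    bergmanIntegrand n ν F z uv

def qnu (n : ℕ) (ν : ℝ) : ℝ := (ν + (n : ℝ) / 2 - 1) / ((n : ℝ) / 2 - 1)

def pSharp (p : ℝ) : ℝ := if p ≤ 2 then p else p / (p - 1)

def qtilde (n : ℕ) (ν p : ℝ) : ℝ≥0∞ :=
  if 1 < (n : ℝ) / 2 * (1 - 1 / p) then
    ENNReal.ofReal ((ν + (n : ℝ) / 2 - 1) / ((n : ℝ) / 2 * (1 - 1 / p) - 1))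
  else ∞

/-- Complex partial derivative `∂/∂z_k`. -/
def pderiv (n : ℕ) (k : Fin n) (F : (Fin n → ℂ) → ℂ) (z : Fin n → ℂ) : ℂ :=
  fderiv ℂ F z (Pi.single k 1)

/-- The wave operator `□ = −(1/4)(∂²/∂z₁² − Σ_{k≥2} ∂²/∂z_k²)`. -/
def waveOp (n : ℕ) [NeZero n] (F : (Fin n → ℂ) → ℂ) (z : Fin n → ℂ) : ℂ :=
  -(1 / 4) * (pderiv n 0 (pderiv n 0 F) z -
    ∑ k ∈ Finset.univ.filter (fun k => k ≠ 0), pderiv n k (pderiv n k F) z)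

/-- The vector `e = (1,0,…,0)` in `ℂ^n`. -/
def eVecC (n : ℕ) [NeZero n] : Fin n → ℂ := fun k => if k = 0 then 1 else 0

/-- The function `F(z) = Q((z+ie)/i)^{−α} (1 + Log Q((z+ie)/i))^{−1/p}` with
`α = (n−1)/p`, using principal branches. -/
def Fex (n : ℕ) [NeZero n] (p : ℝ) (z : Fin n → ℂ) : ℂ :=
  lorentzQC n (fun k => (z k + Complex.I * eVecC n k) / Complex.I)
      ^ ((-(((n : ℝ) - 1) / p) : ℝ) : ℂ) *
    (1 + Complex.log (lorentzQC n (fun k => (z k + Complex.I * eVecC n k) / Complex.I)))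
      ^ ((-(1 / p) : ℝ) : ℂ)

lemma lintegral_fun_norm {E : Type*} [NormedAddCommGroup E] [NormedSpace ℝ E] [Nontrivial E]
    [MeasurableSpace E] [BorelSpace E] [FiniteDimensional ℝ E] (μ : Measure E)
    [μ.IsAddHaarMeasure] {f : ℝ → ℝ≥0∞} (hf : Measurable f) :
    ∫⁻ x, f ‖x‖ ∂μ = μ.toSphere univ *
      ∫⁻ r in Ioi (0 : ℝ), ENNReal.ofReal (r ^ (Module.finrank ℝ E - 1)) * f r :=
  calc
    ∫⁻ x, f ‖x‖ ∂μ = ∫⁻ x : ({(0)}ᶜ : Set E), f ‖x.1‖ ∂(μ.comap (↑)) := by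
      rw [lintegral_subtype_comap (measurableSet_singleton _).compl fun x ↦ f ‖x‖,
        restrict_compl_singleton]
    _ = ∫⁻ x, f x.2 ∂μ.toSphere.prod (.volumeIoiPow (Module.finrank ℝ E - 1)) := by
      simpa using! (μ.measurePreserving_homeomorphUnitSphereProd.lintegral_comp_emb
        (Homeomorph.measurableEmbedding _) (f ∘ Subtype.val ∘ Prod.snd))
    _ = μ.toSphere univ *
        ∫⁻ x : Ioi (0 : ℝ), f x ∂(Measure.volumeIoiPow (Module.finrank ℝ E - 1)) := by
      rw [lintegral_prod _ (by fun_prop)]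
      simp [mul_comm]
    _ = _ := by
      rw [Measure.volumeIoiPow, lintegral_withDensity_eq_lintegral_mul _ (by fun_prop)
        (by fun_prop), ← lintegral_subtype_comap measurableSet_Ioi]
      rfl

/-- The Euclidean norm of the components of `x` orthogonal to `e`. -/
def spatialNorm (n : ℕ) [NeZero n] (x : Fin n → ℝ) : ℝ :=
  √(∑ k ∈ Finset.univ.filter (fun k => k ≠ 0), x k ^ 2)

lemma sum_filter_ne_zero {M : Type*} [AddCommMonoid M] (m : ℕ) [NeZero (m + 1)]
    (f : Fin (m + 1) → M) :
    ∑ k ∈ Finset.univ.filter (fun k => k ≠ 0), f k = ∑ i : Fin m, f i.succ := by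
  rw [Finset.sum_filter, Fin.sum_univ_succ]
  simp [Fin.succ_ne_zero]

lemma lintegral_axial (n : ℕ) [NeZero n] (hn : 2 ≤ n) :
    ∃ c : ℝ≥0∞, c ≠ 0 ∧ c ≠ ∞ ∧ ∀ g : ℝ → ℝ → ℝ≥0∞, Measurable (Function.uncurry g) →
      ∫⁻ x : Fin n → ℝ, g (x 0) (spatialNorm n x) =
        c * ∫⁻ t, ∫⁻ r in Ioi (0 : ℝ), ENNReal.ofReal (r ^ (n - 2)) * g t r := by
  obtain ⟨m, rfl⟩ : ∃ m, n = m + 1 + 1 := ⟨n - 2, by omega⟩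
  have hc : (volume : Measure (EuclideanSpace ℝ (Fin (m + 1)))).toSphere univ ≠ ∞ :=
    measure_ne_top _ _
  refine ⟨(volume : Measure (EuclideanSpace ℝ (Fin (m + 1)))).toSphere univ, ?_, hc, ?_⟩
  · rw [Ne, Measure.measure_univ_eq_zero]
    exact Measure.toSphere_ne_zero _
  intro g hg
  have h1 := (volume_preserving_piFinSuccAbove (fun _ : Fin (m + 1 + 1) => ℝ) 0).lintegral_comp_emb
    (MeasurableEquiv.measurableEmbedding _)
    (fun z : ℝ × (Fin (m + 1) → ℝ) => g z.1 ‖WithLp.toLp 2 z.2‖)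
  have h2 : ∫⁻ x : Fin (m + 1 + 1) → ℝ, g (x 0) (spatialNorm (m + 1 + 1) x) =
      ∫⁻ z : ℝ × (Fin (m + 1) → ℝ), g z.1 ‖WithLp.toLp 2 z.2‖ := by
    rw [← h1]
    refine lintegral_congr fun x => ?_
    rw [spatialNorm, sum_filter_ne_zero, EuclideanSpace.norm_eq]
    simp [MeasurableEquiv.piFinSuccAbove, Fin.insertNthEquiv, Fin.tail]
  rw [h2, Measure.volume_eq_prod, lintegral_prod _ ?_, ← lintegral_const_mul' _ _ hc]
  · refine lintegral_congr fun t => ?_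
    have hgt : Measurable (g t) := hg.comp measurable_prodMk_left
    have h3 := (PiLp.volume_preserving_toLp (Fin (m + 1))).lintegral_comp_emb
      (MeasurableEquiv.toLp 2 _).measurableEmbedding (fun y => g t ‖y‖)
    rw [h3, lintegral_fun_norm _ hgt]
    simp
  · refine (hg.comp (measurable_fst.prodMk ?_)).aemeasurable
    exact ((PiLp.volume_preserving_toLp (Fin (m + 1))).measurable.comp measurable_snd).norm

lemma lintegral_lightCone_coords {G H : ℝ → ℝ≥0∞} (hG : Measurable G) (hH : Measurable H) :
    ∫⁻ t, ∫⁻ r, G (t + r) * H (t - r) = ENNReal.ofReal (1 / 2) * (∫⁻ v, G v) * ∫⁻ u, H u := by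
  rw [lintegral_lintegral_swap (by fun_prop)]
  have h1 : ∀ r, ∫⁻ t, G (t + r) * H (t - r) = ∫⁻ u, G (u + 2 * r) * H u := by
    intro r
    rw [← lintegral_add_right_eq_self (fun t => G (t + r) * H (t - r)) r]
    refine lintegral_congr fun u => ?_
    congr 2 <;> ring
  simp_rw [h1]
  rw [lintegral_lintegral_swap (by fun_prop)]
  have h2 : ∀ u, ∫⁻ r, G (u + 2 * r) * H u = ENNReal.ofReal (1 / 2) * (∫⁻ v, G v) * H u := by
    intro u
    rw [lintegral_mul_const _ (by fun_prop)]
    congr 1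
    have h3 : ∫⁻ r, G (u + 2 * r) = ∫⁻ y, G (u + y) ∂(Measure.map (fun r : ℝ => 2 • r) volume) := by
      rw [lintegral_map (by fun_prop) (by fun_prop)]
      simp
    have h4 := Measure.map_addHaar_smul (volume : Measure ℝ) (r := 2) (by norm_num)
    simp only [smul_eq_mul, nsmul_eq_mul, Nat.cast_ofNat] at h3 h4
    rw [h3, h4, lintegral_smul_measure, lintegral_add_left_eq_self]
    simp
  simp_rw [h2]
  rw [lintegral_const_mul _ hH]

/-- The bilinear form polarizing `lorentzQ`. -/
def lorentzB (n : ℕ) [NeZero n] : (Fin n → ℝ) →ₗ[ℝ] (Fin n → ℝ) →ₗ[ℝ] ℝ :=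
  LinearMap.mk₂ ℝ
    (fun x y => x 0 * y 0 - ∑ k ∈ Finset.univ.filter (fun k => k ≠ 0), x k * y k)
    (fun x x' y => by simp [add_mul, Finset.sum_add_distrib]; ring)
    (fun c x y => by simp [mul_assoc, Finset.mul_sum, mul_sub])
    (fun x y y' => by simp [mul_add, Finset.sum_add_distrib]; ring)
    (fun c x y => by simp [mul_left_comm, Finset.mul_sum, mul_sub])

section Lorentz

variable (n : ℕ) [NeZero n]

lemma lorentzB_apply (x y : Fin n → ℝ) :
    lorentzB n x y = x 0 * y 0 - ∑ k ∈ Finset.univ.filter (fun k => k ≠ 0), x k * y k := rfl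

lemma lorentzB_self (x : Fin n → ℝ) : lorentzB n x x = lorentzQ n x := by
  simp [lorentzB_apply, lorentzQ, sq]

lemma lorentzB_comm (x y : Fin n → ℝ) : lorentzB n x y = lorentzB n y x := by
  simp [lorentzB_apply, mul_comm]

lemma lorentzB_eVec (x : Fin n → ℝ) : lorentzB n (eVec n) x = x 0 := by
  rw [lorentzB_apply, Finset.sum_eq_zero]
  · simp [eVec]
  · intro k hk
    simp [eVec, (Finset.mem_filter.1 hk).2]

lemma lorentzQ_eVec : lorentzQ n (eVec n) = 1 := by
  rw [← lorentzB_self, lorentzB_eVec]; simp [eVec]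

lemma lorentzQ_add (x y : Fin n → ℝ) :
    lorentzQ n (x + y) = lorentzQ n x + 2 * lorentzB n x y + lorentzQ n y := by
  simp only [← lorentzB_self, map_add, LinearMap.add_apply]
  rw [lorentzB_comm n y x]; ring

lemma lorentzQ_smul (c : ℝ) (x : Fin n → ℝ) : lorentzQ n (c • x) = c ^ 2 * lorentzQ n x := by
  simp only [← lorentzB_self, map_smul, LinearMap.smul_apply, smul_eq_mul]; ring

lemma spatialNorm_nonneg (x : Fin n → ℝ) : 0 ≤ spatialNorm n x := Real.sqrt_nonneg _

lemma lorentzQ_eq (x : Fin n → ℝ) : lorentzQ n x = x 0 ^ 2 - spatialNorm n x ^ 2 := by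
  rw [spatialNorm, Real.sq_sqrt (Finset.sum_nonneg fun _ _ => sq_nonneg _), lorentzQ]

lemma mem_lightCone_iff (x : Fin n → ℝ) : x ∈ lightCone n ↔ spatialNorm n x < x 0 := by
  have h := spatialNorm_nonneg n x
  change 0 < x 0 ∧ 0 < lorentzQ n x ↔ _
  rw [lorentzQ_eq]
  constructor
  · rintro ⟨h1, h2⟩
    nlinarith
  · intro h1
    refine ⟨by linarith, by nlinarith⟩

lemma measurable_spatialNorm : Measurable (spatialNorm n) := by
  unfold spatialNorm; fun_prop

lemma measurable_lorentzQ : Measurable (lorentzQ n) := by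
  unfold lorentzQ; fun_prop

lemma measurableSet_lightCone : MeasurableSet (lightCone n) := by
  have : lightCone n = {x | spatialNorm n x < x 0} := Set.ext (mem_lightCone_iff n)
  rw [this]
  exact measurableSet_lt (measurable_spatialNorm n) (measurable_pi_apply 0)

variable {n}

/-- The reverse Cauchy–Schwarz inequality for a timelike vector. -/
lemma lorentzQ_mul_le_sq {y : Fin n → ℝ} (hy : 0 < lorentzQ n y) (x : Fin n → ℝ) :
    lorentzQ n y * lorentzQ n x ≤ lorentzB n y x ^ 2 := by
  have h0 : y 0 ≠ 0 := by
    intro h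
    have := lorentzQ_eq n y
    rw [h] at this
    nlinarith [sq_nonneg (spatialNorm n y)]
  set l : ℝ := x 0 / y 0
  have h1 : lorentzQ n (l • y + (-1 : ℝ) • x) ≤ 0 := by
    rw [lorentzQ_eq]
    have : (l • y + (-1 : ℝ) • x) 0 = 0 := by simp [l, h0]
    rw [this]
    nlinarith [sq_nonneg (spatialNorm n (l • y + (-1 : ℝ) • x))]
  rw [lorentzQ_add, lorentzQ_smul, lorentzQ_smul] at h1
  simp only [map_smul, LinearMap.smul_apply, smul_eq_mul] at h1
  nlinarith [sq_nonneg (l * lorentzQ n y - lorentzB n y x)]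

lemma add_eVec_mem {y : Fin n → ℝ} (hy : y ∈ lightCone n) : 1 < lorentzQ n (y + eVec n) := by
  have h1 : 0 < y 0 := hy.1
  have h2 : 0 < lorentzQ n y := hy.2
  rw [lorentzQ_add, lorentzB_comm, lorentzB_eVec, lorentzQ_eVec]
  linarith

variable (n) in
/-- The value of the complexified Lorentz form at `y - i x`. -/
def lorentzW (y x : Fin n → ℝ) : ℂ := ⟨lorentzQ n y - lorentzQ n x, -2 * lorentzB n y x⟩

lemma lorentzQC_tubePt (x y : Fin n → ℝ) :
    lorentzQC n (fun k => (tubePt n x y k + Complex.I * eVecC n k) / Complex.I) =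
      lorentzW n (y + eVec n) x := by
  have h : ∀ k, (tubePt n x y k + Complex.I * eVecC n k) / Complex.I =
      (((y + eVec n) k : ℝ) : ℂ) - Complex.I * x k := by
    intro k
    have : eVecC n k = (eVec n k : ℝ) := by simp [eVecC, eVec]; split_ifs <;> simp
    rw [this, div_eq_iff Complex.I_ne_zero]
    simp only [tubePt, Pi.add_apply, Complex.ofReal_add]
    linear_combination (x k : ℂ) * Complex.I_sq
  simp only [lorentzQC, h]
  set Y := y + eVec n
  have h2 : ∀ k, ((Y k : ℝ) - Complex.I * x k : ℂ) ^ 2 =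
      ((Y k ^ 2 - x k ^ 2 : ℝ) : ℂ) - 2 * (Y k * x k : ℝ) * Complex.I := by
    intro k
    push_cast
    linear_combination (x k : ℂ) ^ 2 * Complex.I_sq
  simp only [h2, Finset.sum_sub_distrib, ← Finset.sum_mul, ← Finset.mul_sum, ← Complex.ofReal_sum]
  apply Complex.ext
  · simp [lorentzW, lorentzQ, -Complex.ofReal_sub, -Complex.ofReal_sum, -Complex.ofReal_pow]; ring
  · simp [lorentzW, lorentzB_apply, -Complex.ofReal_sub, -Complex.ofReal_sum, -Complex.ofReal_pow,
      -Complex.ofReal_mul]; ring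

lemma norm_lorentzW_sq (y x : Fin n → ℝ) : ‖lorentzW n y x‖ ^ 2 =
    (lorentzQ n y - lorentzQ n x) ^ 2 + 4 * lorentzB n y x ^ 2 := by
  rw [← Complex.normSq_eq_norm_sq, Complex.normSq_apply, lorentzW]; ring

lemma lorentzQ_le_norm_lorentzW {y : Fin n → ℝ} (hy : 0 < lorentzQ n y) (x : Fin n → ℝ) :
    lorentzQ n y ≤ ‖lorentzW n y x‖ := by
  refine le_of_sq_le_sq ?_ (norm_nonneg _)
  rw [norm_lorentzW_sq]
  have h := lorentzQ_mul_le_sq hy x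
  by_cases hx : 0 ≤ lorentzQ n x
  · nlinarith [mul_nonneg hy.le hx]
  · push Not at hx
    nlinarith [sq_nonneg (lorentzB n y x), mul_pos hy (neg_pos.2 hx)]

lemma lorentzW_mem_slitPlane {y : Fin n → ℝ} (hy : 0 < lorentzQ n y) (x : Fin n → ℝ) :
    lorentzW n y x ∈ slitPlane := by
  rw [Complex.mem_slitPlane_iff]
  by_cases h : lorentzB n y x = 0
  · left
    have h1 := lorentzQ_mul_le_sq hy x
    rw [h] at h1
    have : lorentzQ n x ≤ 0 := by
      by_contra! h2
      nlinarith [mul_pos hy h2]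
    simp only [lorentzW]; linarith
  · right
    simpa [lorentzW] using h

lemma norm_lorentzW_smul_eVec (l : ℝ) (x : Fin n → ℝ) :
    ‖lorentzW n (l • eVec n) x‖ =
      √(l ^ 2 + (x 0 + spatialNorm n x) ^ 2) * √(l ^ 2 + (x 0 - spatialNorm n x) ^ 2) := by
  rw [← Real.sqrt_mul (by positivity), eq_comm, Real.sqrt_eq_iff_mul_self_eq (by positivity)
    (norm_nonneg _), ← sq, norm_lorentzW_sq, lorentzQ_smul, lorentzQ_eVec, map_smul,
    LinearMap.smul_apply, lorentzB_eVec, lorentzQ_eq, smul_eq_mul]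
  ring

lemma lorentzW_smul (c : ℝ) (y x : Fin n → ℝ) :
    lorentzW n (c • y) (c • x) = (c ^ 2 : ℝ) * lorentzW n y x := by
  apply Complex.ext
  · rw [Complex.re_ofReal_mul]; simp only [lorentzW, lorentzQ_smul]; ring
  · rw [Complex.im_ofReal_mul]
    simp only [lorentzW, map_smul, LinearMap.smul_apply, smul_eq_mul]; ring

variable (n) in
/-- The reflection about the line spanned by `v`, orthogonal for the Lorentz form. -/
def lorentzReflection (v : Fin n → ℝ) : (Fin n → ℝ) →ₗ[ℝ] (Fin n → ℝ) :=
  (2 / lorentzQ n v) • (lorentzB n v).smulRight v - LinearMap.id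

lemma lorentzReflection_apply (v x : Fin n → ℝ) :
    lorentzReflection n v x = (2 / lorentzQ n v * lorentzB n v x) • v - x := by
  simp [lorentzReflection, smul_smul]

lemma lorentzB_reflection {v : Fin n → ℝ} (hv : lorentzQ n v ≠ 0) (x y : Fin n → ℝ) :
    lorentzB n (lorentzReflection n v x) (lorentzReflection n v y) = lorentzB n x y := by
  simp only [lorentzReflection_apply, map_sub, map_smul, LinearMap.sub_apply,
    LinearMap.smul_apply, smul_eq_mul, lorentzB_self]
  rw [lorentzB_comm n x v]
  field_simp
  ring

lemma lorentzReflection_involutive {v : Fin n → ℝ} (hv : lorentzQ n v ≠ 0) (x : Fin n → ℝ) :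
    lorentzReflection n v (lorentzReflection n v x) = x := by
  have hB : lorentzB n v (lorentzReflection n v x) = lorentzB n v x := by
    simp only [lorentzReflection_apply, map_sub, map_smul, smul_eq_mul, lorentzB_self]
    field_simp; ring
  rw [lorentzReflection_apply, hB, lorentzReflection_apply, sub_sub_cancel]

lemma lorentzW_reflection {v : Fin n → ℝ} (hv : lorentzQ n v ≠ 0) (y x : Fin n → ℝ) :
    lorentzW n (lorentzReflection n v y) (lorentzReflection n v x) = lorentzW n y x := by
  simp only [lorentzW, ← lorentzB_self, lorentzB_reflection hv]

lemma measurePreserving_lorentzReflection {v : Fin n → ℝ} (hv : lorentzQ n v ≠ 0) :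
    MeasurePreserving (lorentzReflection n v) := by
  have hd : LinearMap.det (lorentzReflection n v) * LinearMap.det (lorentzReflection n v) = 1 := by
    rw [← LinearMap.det_comp, ← LinearMap.det_id (M := Fin n → ℝ) (A := ℝ)]
    congr 1
    exact LinearMap.ext (lorentzReflection_involutive hv)
  refine ⟨(LinearMap.continuous_of_finiteDimensional _).measurable, ?_⟩
  rw [Measure.map_linearMap_addHaar_eq_smul_addHaar _ (left_ne_zero_of_mul_eq_one hd), abs_inv]
  rcases mul_self_eq_one_iff.1 hd with h | h <;> simp [h]

lemma lintegral_lorentzW {y : Fin n → ℝ} (hy : y ∈ lightCone n) {f : ℂ → ℝ≥0∞}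
    (hf : Measurable f) :
    ∫⁻ x, f (lorentzW n y x) = ENNReal.ofReal (lorentzQ n y ^ ((n : ℝ) / 2)) *
      ∫⁻ x, f ((lorentzQ n y : ℝ) * lorentzW n (eVec n) x) := by
  have hQ : 0 < lorentzQ n y := hy.2
  have hy0 : 0 < y 0 := hy.1
  set c := √(lorentzQ n y)
  have hc : 0 < c := Real.sqrt_pos.2 hQ
  have hc2 : c ^ 2 = lorentzQ n y := Real.sq_sqrt hQ.le
  set v := c⁻¹ • y + eVec n
  have hBv : lorentzB n v (eVec n) = c⁻¹ * y 0 + 1 := by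
    rw [lorentzB_comm, lorentzB_eVec]; simp [v, eVec]
  have hQv : lorentzQ n v = 2 * (c⁻¹ * y 0 + 1) := by
    rw [lorentzQ_add, lorentzQ_smul, lorentzQ_eVec, lorentzB_comm, lorentzB_eVec, ← hc2]
    simp only [Pi.smul_apply, smul_eq_mul]
    field_simp
    ring
  have hpos : 0 < c⁻¹ * y 0 + 1 := by positivity
  have hv : lorentzQ n v ≠ 0 := by rw [hQv]; positivity
  have hS : c • lorentzReflection n v (eVec n) = y := by
    rw [lorentzReflection_apply, hBv, hQv]
    have : 2 / (2 * (c⁻¹ * y 0 + 1)) * (c⁻¹ * y 0 + 1) = 1 := by field_simp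
    rw [this]
    simp [v, smul_smul, hc.ne']
  have hmW : ∀ y' : Fin n → ℝ, Measurable (lorentzW n y') := by
    intro y'
    have h1 : Measurable fun x => lorentzQ n y' - lorentzQ n x :=
      measurable_const.sub (measurable_lorentzQ n)
    have h2 : Measurable fun x => -2 * lorentzB n y' x :=
      (LinearMap.continuous_of_finiteDimensional (lorentzB n y')).measurable.const_mul _
    have h3 : lorentzW n y' = fun x => ((lorentzQ n y' - lorentzQ n x : ℝ) : ℂ) +
        ((-2 * lorentzB n y' x : ℝ) : ℂ) * Complex.I := by
      ext x; exact (Complex.mk_eq_add_mul_I _ _)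
    rw [h3]
    exact (Complex.measurable_ofReal.comp h1).add
      ((Complex.measurable_ofReal.comp h2).mul_const _)
  have h1 : ∫⁻ x, f (lorentzW n y (c • x)) = ENNReal.ofReal (c ^ n)⁻¹ *
      ∫⁻ x, f (lorentzW n y x) := by
    rw [← lintegral_map (f := fun x => f (lorentzW n y x)) (hf.comp (hmW y)) (by fun_prop),
      Measure.map_addHaar_smul _ hc.ne', lintegral_smul_measure]
    simp [abs_of_pos hc]
  have h2 : ∫⁻ x, f (lorentzW n y (c • x)) =
      ∫⁻ x, f ((lorentzQ n y : ℝ) * lorentzW n (eVec n) x) := by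
    have h3 := (measurePreserving_lorentzReflection hv).lintegral_comp
      (f := fun x => f (lorentzW n y (c • x)))
      (hf.comp ((hmW y).comp (measurable_const_smul c)))
    rw [← h3]
    refine lintegral_congr fun x => ?_
    conv_lhs => rw [← hS]
    rw [lorentzW_smul, lorentzW_reflection hv, hc2]
  rw [← h2, h1, ← mul_assoc, ← ENNReal.ofReal_mul (by positivity)]
  have : lorentzQ n y ^ ((n : ℝ) / 2) * (c ^ n)⁻¹ = 1 := by
    rw [← hc2, ← Real.rpow_natCast c 2, ← Real.rpow_mul hc.le]
    push_cast
    rw [mul_div_cancel₀ _ two_ne_zero, Real.rpow_natCast]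
    field_simp
  rw [this]; simp

end Lorentz

/-- The function `w ^ a * (1 + Log w) ^ b`. -/
def powLog (a b : ℝ) (w : ℂ) : ℂ := w ^ (a : ℂ) * (1 + Complex.log w) ^ (b : ℂ)

lemma one_add_log_re (w : ℂ) : (1 + Complex.log w).re = 1 + Real.log ‖w‖ := by
  simp [Complex.log_re]

lemma one_add_log_le_norm (w : ℂ) : 1 + Real.log ‖w‖ ≤ ‖1 + Complex.log w‖ := by
  rw [← one_add_log_re]
  exact Complex.re_le_norm _

lemma hasDerivAt_powLog (a b : ℝ) {w : ℂ} (hw : w ∈ slitPlane) (hw1 : 1 < ‖w‖) :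
    HasDerivAt (powLog a b) (a * powLog (a - 1) b w + b * powLog (a - 1) (b - 1) w) w := by
  have hw0 : w ≠ 0 := Complex.slitPlane_ne_zero hw
  have hL : 1 + Complex.log w ∈ slitPlane := by
    left
    rw [one_add_log_re]
    have := Real.log_pos hw1
    linarith
  have h1 : HasDerivAt (fun w : ℂ => w ^ (a : ℂ)) (a * w ^ ((a : ℂ) - 1)) w := by
    simpa using (hasDerivAt_id w).cpow_const (c := (a : ℂ)) hw
  have h2 := ((Complex.hasDerivAt_log hw).const_add 1).cpow_const (c := (b : ℂ)) hL
  refine (h1.mul h2).congr_deriv ?_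
  simp only [powLog, Complex.ofReal_sub, Complex.ofReal_one, Complex.cpow_sub _ _ hw0,
    Complex.cpow_one]
  ring

lemma norm_powLog_le (a : ℝ) {b : ℝ} (hb : b ≤ 0) {w : ℂ} (hw : 1 < ‖w‖) :
    ‖powLog a b w‖ ≤ ‖w‖ ^ a * (1 + Real.log ‖w‖) ^ b := by
  rw [powLog, norm_mul, Complex.norm_cpow_real, Complex.norm_cpow_real]
  have := Real.log_pos hw
  gcongr ?_ * ?_
  exact Real.rpow_le_rpow_of_nonpos (by linarith) (one_add_log_le_norm w) hb

/-- The derivative of `powLog a b`. -/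
def powLogDeriv (a b : ℝ) (w : ℂ) : ℂ := a * powLog (a - 1) b w + b * powLog (a - 1) (b - 1) w

/-- The second derivative of `powLog a b`. -/
def powLogDeriv2 (a b : ℝ) (w : ℂ) : ℂ :=
  a * powLogDeriv (a - 1) b w + b * powLogDeriv (a - 1) (b - 1) w

lemma norm_powLogDeriv_le (a : ℝ) {b : ℝ} (hb : b ≤ 0) {w : ℂ} (hw : 1 < ‖w‖) :
    ‖powLogDeriv a b w‖ ≤ (|a| + |b|) * (‖w‖ ^ (a - 1) * (1 + Real.log ‖w‖) ^ b) := by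
  have hl := Real.log_pos hw
  have h1 := norm_powLog_le (a - 1) hb hw
  have h2 := norm_powLog_le (a - 1) (b := b - 1) (by linarith) hw
  have h3 : (1 + Real.log ‖w‖) ^ (b - 1) ≤ (1 + Real.log ‖w‖) ^ b :=
    Real.rpow_le_rpow_of_exponent_le (by linarith) (by linarith)
  calc ‖powLogDeriv a b w‖ ≤ |a| * ‖powLog (a - 1) b w‖ + |b| * ‖powLog (a - 1) (b - 1) w‖ := by
        refine (norm_add_le _ _).trans ?_
        simp
    _ ≤ |a| * (‖w‖ ^ (a - 1) * (1 + Real.log ‖w‖) ^ b) +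
        |b| * (‖w‖ ^ (a - 1) * (1 + Real.log ‖w‖) ^ b) := by
        gcongr
        exact h2.trans (by gcongr)
    _ = _ := by ring

lemma norm_powLogDeriv2_le (a : ℝ) {b : ℝ} (hb : b ≤ 0) {w : ℂ} (hw : 1 < ‖w‖) :
    ‖powLogDeriv2 a b w‖ ≤ (|a| * (|a - 1| + |b|) + |b| * (|a - 1| + |b - 1|)) *
      (‖w‖ ^ (a - 2) * (1 + Real.log ‖w‖) ^ b) := by
  have hl := Real.log_pos hw
  have h1 := norm_powLogDeriv_le (a - 1) hb hw
  have h2 := norm_powLogDeriv_le (a - 1) (b := b - 1) (by linarith) hw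
  rw [show a - 1 - 1 = a - 2 by ring] at h1 h2
  have h3 : (1 + Real.log ‖w‖) ^ (b - 1) ≤ (1 + Real.log ‖w‖) ^ b :=
    Real.rpow_le_rpow_of_exponent_le (by linarith) (by linarith)
  calc ‖powLogDeriv2 a b w‖ ≤
        |a| * ‖powLogDeriv (a - 1) b w‖ + |b| * ‖powLogDeriv (a - 1) (b - 1) w‖ := by
        refine (norm_add_le _ _).trans ?_
        simp
    _ ≤ |a| * ((|a - 1| + |b|) * (‖w‖ ^ (a - 2) * (1 + Real.log ‖w‖) ^ b)) +
        |b| * ((|a - 1| + |b - 1|) * (‖w‖ ^ (a - 2) * (1 + Real.log ‖w‖) ^ b)) := by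
        gcongr
        exact h2.trans (by gcongr)
    _ = _ := by ring

lemma tubePt_re_im {n : ℕ} (z : Fin n → ℂ) : tubePt n (fun k => (z k).re) (fun k => (z k).im) = z := by
  ext k; simp [tubePt, Complex.re_add_im]

lemma pderiv_eq_deriv {n : ℕ} {F : (Fin n → ℂ) → ℂ} {z : Fin n → ℂ} (hF : DifferentiableAt ℂ F z)
    (k : Fin n) : pderiv n k F z = deriv (fun t : ℂ => F (z + t • Pi.single k 1)) 0 := by
  rw [pderiv, ← hF.lineDeriv_eq_fderiv]; rfl

lemma pderiv_mul {n : ℕ} {F G : (Fin n → ℂ) → ℂ} {z : Fin n → ℂ} (hF : DifferentiableAt ℂ F z)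
    (hG : DifferentiableAt ℂ G z) (k : Fin n) :
    pderiv n k (fun z => F z * G z) z = pderiv n k F z * G z + F z * pderiv n k G z := by
  simp only [pderiv, fderiv_fun_mul hF hG]
  simp; ring

section Wave

variable {n : ℕ} [NeZero n]

variable (n) in
/-- The polynomial `Q((z + i e) / i)`. -/
def shiftedQ (z : Fin n → ℂ) : ℂ :=
  lorentzQC n (fun k => (z k + Complex.I * eVecC n k) / Complex.I)

lemma shiftedQ_eq (z : Fin n → ℂ) : shiftedQ n z =
    -(z 0 + Complex.I) ^ 2 + ∑ k ∈ Finset.univ.filter (fun k => k ≠ 0), z k ^ 2 := by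
  have h : ∀ w : ℂ, (w / Complex.I) ^ 2 = - w ^ 2 := by intro w; rw [div_pow, Complex.I_sq, div_neg, div_one]
  simp only [shiftedQ, lorentzQC, h, Finset.sum_neg_distrib, sub_neg_eq_add]
  congr 1
  · simp [eVecC]
  · refine Finset.sum_congr rfl fun k hk => ?_
    simp [eVecC, (Finset.mem_filter.1 hk).2]

lemma inTube_tubePt {x y : Fin n → ℝ} : inTube n (tubePt n x y) ↔ y ∈ lightCone n := by
  simp [inTube, tubePt]

lemma shiftedQ_tubePt (x y : Fin n → ℝ) :
    shiftedQ n (tubePt n x y) = lorentzW n (y + eVec n) x := lorentzQC_tubePt x y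

lemma shiftedQ_mem {z : Fin n → ℂ} (hz : inTube n z) :
    shiftedQ n z ∈ slitPlane ∧ 1 < ‖shiftedQ n z‖ := by
  rw [← tubePt_re_im z] at hz ⊢
  have hQ := add_eVec_mem (inTube_tubePt.1 hz)
  rw [shiftedQ_tubePt]
  exact ⟨lorentzW_mem_slitPlane (by linarith) _,
    hQ.trans_le (lorentzQ_le_norm_lorentzW (by linarith) _)⟩

lemma isOpen_tube : IsOpen {z : Fin n → ℂ | inTube n z} := by
  have : {z : Fin n → ℂ | inTube n z} = {z | 0 < (z 0).im ∧ 0 < (z 0).im ^ 2 -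
    ∑ k ∈ Finset.univ.filter (fun k => k ≠ 0), (z k).im ^ 2} := rfl
  rw [this]
  exact (isOpen_lt (f := fun _ : Fin n → ℂ => (0 : ℝ)) (g := fun z => (z 0).im) (by fun_prop)
    (by fun_prop)).inter (isOpen_lt (f := fun _ : Fin n → ℂ => (0 : ℝ))
      (g := fun z => (z 0).im ^ 2 - ∑ k ∈ Finset.univ.filter (fun k => k ≠ 0), (z k).im ^ 2)
      (by fun_prop) (by fun_prop))

variable (n) in
/-- The complex partial derivative of `shiftedQ` in the direction `k`. -/
def shiftedQDeriv (k : Fin n) (z : Fin n → ℂ) : ℂ :=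
  if k = 0 then -2 * (z 0 + Complex.I) else 2 * z k

lemma differentiable_shiftedQ : Differentiable ℂ (shiftedQ n) := by
  have : shiftedQ n = fun z => _ := funext shiftedQ_eq
  rw [this]; fun_prop

lemma pderiv_shiftedQ (k : Fin n) (z : Fin n → ℂ) :
    pderiv n k (shiftedQ n) z = shiftedQDeriv n k z := by
  rw [pderiv_eq_deriv (differentiable_shiftedQ z)]
  simp only [shiftedQ_eq, shiftedQDeriv]
  refine HasDerivAt.deriv ?_
  have h : ∀ j : Fin n, HasDerivAt (fun t : ℂ => (z + t • (Pi.single k 1 : Fin n → ℂ)) j)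
      ((Pi.single k 1 : Fin n → ℂ) j) 0 := by
    intro j
    simpa using ((hasDerivAt_id (0 : ℂ)).mul_const ((Pi.single k 1 : Fin n → ℂ) j)).const_add (z j)
  have h1 := (((h 0).add_const Complex.I).pow 2).neg.add
    (HasDerivAt.fun_sum fun j (_ : j ∈ Finset.univ.filter (fun k => k ≠ 0)) => (h j).pow 2)
  refine h1.congr_deriv ?_
  split_ifs with hk
  · subst hk
    rw [Finset.sum_eq_zero]
    · simp
    · intro j hj
      simp [(Finset.mem_filter.1 hj).2]
  · rw [Finset.sum_eq_single_of_mem k (by simp [hk])]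
    · simp [Ne.symm hk]
    · intro j _ hj
      simp [hj]

lemma pderiv_shiftedQDeriv (k : Fin n) (z : Fin n → ℂ) :
    pderiv n k (shiftedQDeriv n k) z = if k = 0 then -2 else 2 := by
  rw [pderiv_eq_deriv (by unfold shiftedQDeriv; split_ifs <;> fun_prop)]
  refine HasDerivAt.deriv ?_
  have h : HasDerivAt (fun t : ℂ => (z + t • (Pi.single k 1 : Fin n → ℂ)) k) 1 0 := by
    simpa using (hasDerivAt_id (0 : ℂ)).const_add (z k)
  unfold shiftedQDeriv
  split_ifs with hk
  · subst hk
    simpa using (h.add_const Complex.I).const_mul (-2)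
  · simpa using h.const_mul 2

lemma differentiable_shiftedQDeriv (k : Fin n) : Differentiable ℂ (shiftedQDeriv n k) := by
  unfold shiftedQDeriv; split_ifs <;> fun_prop

lemma differentiableAt_powLog_shiftedQ (a b : ℝ) {z : Fin n → ℂ} (hz : inTube n z) :
    DifferentiableAt ℂ (fun z => powLog a b (shiftedQ n z)) z :=
  (hasDerivAt_powLog a b (shiftedQ_mem hz).1 (shiftedQ_mem hz).2).differentiableAt.comp z
    (differentiable_shiftedQ z)

lemma pderiv_powLog_shiftedQ (a b : ℝ) {z : Fin n → ℂ} (hz : inTube n z) (k : Fin n) :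
    pderiv n k (fun z => powLog a b (shiftedQ n z)) z =
      powLogDeriv a b (shiftedQ n z) * shiftedQDeriv n k z := by
  have h1 := hasDerivAt_powLog a b (shiftedQ_mem hz).1 (shiftedQ_mem hz).2
  have h2 := (h1.comp_hasFDerivAt z (differentiable_shiftedQ z).hasFDerivAt).fderiv
  rw [← pderiv_shiftedQ k z]
  simp only [pderiv]
  change (fderiv ℂ (powLog a b ∘ shiftedQ n) z) _ = _
  rw [h2]; rfl

lemma differentiableAt_powLogDeriv_shiftedQ (a b : ℝ) {z : Fin n → ℂ} (hz : inTube n z) :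
    DifferentiableAt ℂ (fun z => powLogDeriv a b (shiftedQ n z)) z :=
  ((differentiableAt_powLog_shiftedQ (a - 1) b hz).const_mul _).add
    ((differentiableAt_powLog_shiftedQ (a - 1) (b - 1) hz).const_mul _)

lemma pderiv_powLogDeriv_shiftedQ (a b : ℝ) {z : Fin n → ℂ} (hz : inTube n z) (k : Fin n) :
    pderiv n k (fun z => powLogDeriv a b (shiftedQ n z)) z =
      powLogDeriv2 a b (shiftedQ n z) * shiftedQDeriv n k z := by
  have h1 := differentiableAt_powLog_shiftedQ (a - 1) b hz
  have h2 := differentiableAt_powLog_shiftedQ (a - 1) (b - 1) hz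
  have h3 := pderiv_powLog_shiftedQ (a - 1) b hz k
  have h4 := pderiv_powLog_shiftedQ (a - 1) (b - 1) hz k
  simp only [pderiv] at h3 h4 ⊢
  have h5 := ((h1.hasFDerivAt.const_mul (a : ℂ)).add (h2.hasFDerivAt.const_mul (b : ℂ))).fderiv
  change fderiv ℂ ((fun z => (a : ℂ) * powLog (a - 1) b (shiftedQ n z)) +
    fun z => (b : ℂ) * powLog (a - 1) (b - 1) (shiftedQ n z)) z _ = _
  rw [h5]
  simp only [add_apply, smul_apply, h3, h4, smul_eq_mul,
    powLogDeriv2]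
  ring

lemma pderiv_pderiv_powLog_shiftedQ (a b : ℝ) {z : Fin n → ℂ} (hz : inTube n z) (k : Fin n) :
    pderiv n k (pderiv n k (fun z => powLog a b (shiftedQ n z))) z =
      powLogDeriv2 a b (shiftedQ n z) * shiftedQDeriv n k z ^ 2 +
        powLogDeriv a b (shiftedQ n z) * (if k = 0 then -2 else 2) := by
  have h1 : pderiv n k (fun z => powLog a b (shiftedQ n z)) =ᶠ[nhds z]
      fun z => powLogDeriv a b (shiftedQ n z) * shiftedQDeriv n k z := by
    filter_upwards [isOpen_tube.mem_nhds hz] with z' hz'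
    exact pderiv_powLog_shiftedQ a b hz' k
  rw [pderiv, h1.fderiv_eq, ← pderiv, pderiv_mul (differentiableAt_powLogDeriv_shiftedQ a b hz)
    (differentiable_shiftedQDeriv k z), pderiv_powLogDeriv_shiftedQ a b hz, pderiv_shiftedQDeriv]
  ring

lemma waveOp_powLog_shiftedQ (a b : ℝ) {z : Fin n → ℂ} (hz : inTube n z) :
    waveOp n (fun z => powLog a b (shiftedQ n z)) z =
      shiftedQ n z * powLogDeriv2 a b (shiftedQ n z) +
        (n / 2 : ℂ) * powLogDeriv a b (shiftedQ n z) := by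
  rw [waveOp, pderiv_pderiv_powLog_shiftedQ a b hz]
  have h1 : ∑ k ∈ Finset.univ.filter (fun k : Fin n => k ≠ 0),
      pderiv n k (pderiv n k (fun z => powLog a b (shiftedQ n z))) z =
      ∑ k ∈ Finset.univ.filter (fun k : Fin n => k ≠ 0),
        (powLogDeriv2 a b (shiftedQ n z) * 4 * z k ^ 2 + powLogDeriv a b (shiftedQ n z) * 2) := by
    refine Finset.sum_congr rfl fun k hk => ?_
    rw [pderiv_pderiv_powLog_shiftedQ a b hz, shiftedQDeriv, if_neg (Finset.mem_filter.1 hk).2,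
      if_neg (Finset.mem_filter.1 hk).2]
    ring
  have h2 : ((Finset.univ.filter (fun k : Fin n => k ≠ 0)).card : ℂ) = n - 1 := by
    rw [Finset.filter_ne', Finset.card_erase_of_mem (Finset.mem_univ _), Finset.card_univ,
      Fintype.card_fin, Nat.cast_sub (NeZero.one_le), Nat.cast_one]
  rw [h1, Finset.sum_add_distrib, ← Finset.mul_sum, Finset.sum_const, nsmul_eq_mul, h2]
  have h3 : ∑ k ∈ Finset.univ.filter (fun k => k ≠ 0), z k ^ 2 =
      shiftedQ n z + (z 0 + Complex.I) ^ 2 := by rw [shiftedQ_eq]; ring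
  rw [h3]
  simp only [shiftedQDeriv, if_true]
  ring

lemma norm_waveOp_powLog_shiftedQ_le (n : ℕ) [NeZero n] (a : ℝ) {b : ℝ} (hb : b ≤ 0) :
    ∃ K : ℝ, 0 ≤ K ∧ ∀ z : Fin n → ℂ, inTube n z →
      ‖waveOp n (fun z => powLog a b (shiftedQ n z)) z‖ ≤
        K * (‖shiftedQ n z‖ ^ (a - 1) * (1 + Real.log ‖shiftedQ n z‖) ^ b) := by
  refine ⟨(|a| * (|a - 1| + |b|) + |b| * (|a - 1| + |b - 1|)) + n / 2 * (|a| + |b|),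
    by positivity, fun z hz => ?_⟩
  obtain ⟨-, hw⟩ := shiftedQ_mem hz
  rw [waveOp_powLog_shiftedQ a b hz]
  set w := shiftedQ n z
  have h1 := norm_powLogDeriv_le a hb hw
  have h2 := norm_powLogDeriv2_le a hb hw
  have h3 : ‖w‖ * ‖w‖ ^ (a - 2) = ‖w‖ ^ (a - 1) := by
    rw [mul_comm, ← Real.rpow_add_one (by linarith)]; congr 1; ring
  calc _ ≤ ‖w‖ * ‖powLogDeriv2 a b w‖ + n / 2 * ‖powLogDeriv a b w‖ := by
        refine (norm_add_le _ _).trans ?_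
        simp
    _ ≤ ‖w‖ * ((|a| * (|a - 1| + |b|) + |b| * (|a - 1| + |b - 1|)) *
        (‖w‖ ^ (a - 2) * (1 + Real.log ‖w‖) ^ b)) +
        n / 2 * ((|a| + |b|) * (‖w‖ ^ (a - 1) * (1 + Real.log ‖w‖) ^ b)) := by gcongr
    _ = _ := by rw [← h3]; ring

lemma Fex_eq (n : ℕ) [NeZero n] (p : ℝ) :
    Fex n p = fun z => powLog (-(((n : ℝ) - 1) / p)) (-(1 / p)) (shiftedQ n z) := rfl

end Wave

lemma lintegral_inv_one_add_sq_lt_top : ∫⁻ v : ℝ, ENNReal.ofReal ((1 + v ^ 2)⁻¹) < ∞ :=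
  integrable_inv_one_add_sq.lintegral_lt_top

lemma lintegral_norm_lorentzW_eVec_lt_top (n : ℕ) [NeZero n] (hn : 2 ≤ n) {s : ℝ} (hs : n ≤ s) :
    ∫⁻ x, ENNReal.ofReal (‖lorentzW n (eVec n) x‖ ^ (-s)) < ∞ := by
  obtain ⟨c, -, hc, hg⟩ := lintegral_axial n hn
  have h1 := hg (fun t r => ENNReal.ofReal
    ((√((1 : ℝ) ^ 2 + (t + r) ^ 2) * √((1 : ℝ) ^ 2 + (t - r) ^ 2)) ^ (-s)))
    (by unfold Function.uncurry; fun_prop)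
  have h2 : ∀ x, ‖lorentzW n (eVec n) x‖ = √((1 : ℝ) ^ 2 + (x 0 + spatialNorm n x) ^ 2) *
      √((1 : ℝ) ^ 2 + (x 0 - spatialNorm n x) ^ 2) := by
    intro x
    rw [← norm_lorentzW_smul_eVec, one_smul]
  simp_rw [h2]
  rw [h1]
  refine ENNReal.mul_lt_top hc.lt_top ?_
  refine (lintegral_mono (fun t => ?_) : _ ≤ ∫⁻ t, ∫⁻ r, ENNReal.ofReal ((1 + (t + r) ^ 2)⁻¹) *
    ENNReal.ofReal ((1 + (t - r) ^ 2)⁻¹)).trans_lt ?_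
  · refine (setLIntegral_mono (by fun_prop) fun r hr => ?_).trans (setLIntegral_le_lintegral _ _)
    have hr0 : 0 < r := hr
    rw [← ENNReal.ofReal_mul (by positivity), ← ENNReal.ofReal_mul (by positivity)]
    refine ENNReal.ofReal_le_ofReal ?_
    set A := √((1 : ℝ) ^ 2 + (t + r) ^ 2) with hA
    set B := √((1 : ℝ) ^ 2 + (t - r) ^ 2) with hB
    have hA2 : A ^ 2 = 1 + (t + r) ^ 2 := by rw [hA, Real.sq_sqrt (by positivity)]; ring
    have hB2 : B ^ 2 = 1 + (t - r) ^ 2 := by rw [hB, Real.sq_sqrt (by positivity)]; ring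
    have hA1 : 1 ≤ A := Real.one_le_sqrt.2 (by nlinarith [sq_nonneg (t + r)])
    have hB1 : 1 ≤ B := Real.one_le_sqrt.2 (by nlinarith [sq_nonneg (t - r)])
    have hAa : t + r ≤ A := le_of_sq_le_sq (by linarith) (by linarith)
    have hBb : -(t - r) ≤ B := le_of_sq_le_sq (by nlinarith) (by linarith)
    have hAB : r ≤ A * B := by nlinarith [mul_nonneg (sub_nonneg.2 hA1) (sub_nonneg.2 hB1)]
    have hAB1 : 1 ≤ A * B := by nlinarith
    rw [← hA2, ← hB2, ← mul_inv, ← mul_pow]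
    calc r ^ (n - 2) * (A * B) ^ (-s) ≤ (A * B) ^ (n - 2) * (A * B) ^ (-(n : ℝ)) := by
          gcongr
      _ = ((A * B) ^ 2)⁻¹ := by
          rw [Real.rpow_neg (by positivity), Real.rpow_natCast,
            ← div_eq_mul_inv, div_eq_iff (by positivity), inv_mul_eq_div, eq_div_iff (by positivity),
            ← pow_add]
          congr 1; omega
  · rw [lintegral_lightCone_coords (G := fun v => ENNReal.ofReal ((1 + v ^ 2)⁻¹))
      (H := fun v => ENNReal.ofReal ((1 + v ^ 2)⁻¹)) (by fun_prop) (by fun_prop)]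
    exact ENNReal.mul_lt_top (ENNReal.mul_lt_top ENNReal.ofReal_lt_top
      lintegral_inv_one_add_sq_lt_top) lintegral_inv_one_add_sq_lt_top

lemma lintegral_norm_lorentzW_rpow {n : ℕ} [NeZero n] {y : Fin n → ℝ} (hy : y ∈ lightCone n)
    (s : ℝ) : ∫⁻ x, ENNReal.ofReal (‖lorentzW n y x‖ ^ (-s)) =
      ENNReal.ofReal (lorentzQ n y ^ ((n : ℝ) / 2 - s)) *
        ∫⁻ x, ENNReal.ofReal (‖lorentzW n (eVec n) x‖ ^ (-s)) := by
  have hQ : 0 < lorentzQ n y := hy.2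
  rw [lintegral_lorentzW hy (f := fun w => ENNReal.ofReal (‖w‖ ^ (-s))) (by fun_prop)]
  have h : ∀ x, ENNReal.ofReal (‖((lorentzQ n y : ℝ) : ℂ) * lorentzW n (eVec n) x‖ ^ (-s)) =
      ENNReal.ofReal (lorentzQ n y ^ (-s)) *
        ENNReal.ofReal (‖lorentzW n (eVec n) x‖ ^ (-s)) := by
    intro x
    rw [norm_mul, Complex.norm_real, Real.norm_of_nonneg hQ.le,
      Real.mul_rpow hQ.le (norm_nonneg _), ENNReal.ofReal_mul (by positivity)]
  simp_rw [h]
  rw [lintegral_const_mul' _ _ ENNReal.ofReal_ne_top, ← mul_assoc,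
    ← ENNReal.ofReal_mul (by positivity), ← Real.rpow_add hQ, sub_eq_add_neg]

lemma eVec_mem_lightCone (n : ℕ) [NeZero n] : eVec n ∈ lightCone n :=
  ⟨by simp [eVec], by rw [lorentzQ_eVec]; norm_num⟩

lemma add_eVec_mem_lightCone {n : ℕ} [NeZero n] {y : Fin n → ℝ} (hy : y ∈ lightCone n) :
    y + eVec n ∈ lightCone n := by
  have h1 : 0 < y 0 := hy.1
  exact ⟨by simp [eVec]; linarith, zero_lt_one.trans (add_eVec_mem hy)⟩

lemma nnnorm_rpow_eq_ofReal (z : ℂ) {p : ℝ} (hp : 0 ≤ p) :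
    (‖z‖₊ : ℝ≥0∞) ^ p = ENNReal.ofReal (‖z‖ ^ p) := by
  rw [← ENNReal.ofReal_rpow_of_nonneg (norm_nonneg _) hp, ofReal_norm, enorm_eq_nnnorm]

lemma lintegral_waveOp_Fex_le (n : ℕ) [NeZero n] (hn : 2 ≤ n) {p : ℝ} (hp : 1 ≤ p) :
    ∃ C : ℝ≥0∞, C ≠ ∞ ∧ ∀ y ∈ lightCone n,
      ∫⁻ x : Fin n → ℝ, (‖waveOp n (Fex n p) (tubePt n x y)‖₊ : ℝ≥0∞) ^ p ≤
        C * ENNReal.ofReal ((1 + Real.log (lorentzQ n (y + eVec n)))⁻¹ *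
          lorentzQ n (y + eVec n) ^ (1 - (n : ℝ) / 2 - p)) := by
  have hp0 : 0 < p := by linarith
  obtain ⟨K, hK, hKw⟩ := norm_waveOp_powLog_shiftedQ_le n (-(((n : ℝ) - 1) / p))
    (b := -(1 / p)) (by rw [neg_nonpos]; positivity)
  refine ⟨ENNReal.ofReal (K ^ p) *
    ∫⁻ x, ENNReal.ofReal (‖lorentzW n (eVec n) x‖ ^ (-(n - 1 + p))),
    ENNReal.mul_ne_top ENNReal.ofReal_ne_top
      (lintegral_norm_lorentzW_eVec_lt_top n hn (by linarith)).ne, fun y hy => ?_⟩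
  have hY := add_eVec_mem_lightCone hy
  have hQ1 := add_eVec_mem hy
  set Y := y + eVec n
  have hlQ := Real.log_pos hQ1
  have hpt : ∀ x, (‖waveOp n (Fex n p) (tubePt n x y)‖₊ : ℝ≥0∞) ^ p ≤
      ENNReal.ofReal (K ^ p * (1 + Real.log (lorentzQ n Y))⁻¹) *
        ENNReal.ofReal (‖lorentzW n Y x‖ ^ (-(n - 1 + p))) := by
    intro x
    have hle := lorentzQ_le_norm_lorentzW (zero_lt_one.trans hQ1) x
    have hw1 : 1 < ‖lorentzW n Y x‖ := hQ1.trans_le hle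
    have hlw := Real.log_pos hw1
    have h1 := hKw (tubePt n x y) (inTube_tubePt.2 hy)
    rw [← Fex_eq, shiftedQ_tubePt] at h1
    rw [nnnorm_rpow_eq_ofReal _ hp0.le, ← ENNReal.ofReal_mul (by positivity)]
    refine ENNReal.ofReal_le_ofReal ?_
    calc _ ≤ (K * (‖lorentzW n Y x‖ ^ (-(((n : ℝ) - 1) / p) - 1) *
          (1 + Real.log ‖lorentzW n Y x‖) ^ (-(1 / p)))) ^ p := by gcongr
      _ = K ^ p * (1 + Real.log ‖lorentzW n Y x‖)⁻¹ * ‖lorentzW n Y x‖ ^ (-(n - 1 + p)) := by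
          rw [Real.mul_rpow hK (by positivity), Real.mul_rpow (by positivity) (by positivity),
            ← Real.rpow_mul (norm_nonneg _), ← Real.rpow_mul (by linarith), ← Real.rpow_neg_one]
          have e1 : (-(((n : ℝ) - 1) / p) - 1) * p = -(n - 1 + p) := by field_simp; ring
          have e2 : -(1 / p) * p = -1 := by field_simp
          rw [e1, e2]; ring
      _ ≤ _ := by gcongr
  refine (lintegral_mono hpt).trans (le_of_eq ?_)
  rw [lintegral_const_mul' _ _ ENNReal.ofReal_ne_top, lintegral_norm_lorentzW_rpow hY,
    ENNReal.ofReal_mul (by positivity), ENNReal.ofReal_mul (by positivity),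
    show (n : ℝ) / 2 - (n - 1 + p) = 1 - n / 2 - p by ring]
  ring

lemma coneIntegrand_le {a ν p r u v : ℝ} (ha : 1 < a) (hp : 0 < p)
    (hr : (ν + a - 1) / (a - 1) ≤ r) (hr1 : 0 ≤ r) (hu : 0 < u) (hv : 0 < v) :
    ((1 + Real.log ((u + 1) * (v + 1)))⁻¹ * ((u + 1) * (v + 1)) ^ (1 - a - p)) ^ r *
      (u * v) ^ (ν + p * r - a) ≤
    (u ^ (ν - a) * (u + 1) ^ (-(ν + a - 1))) *
      (v ^ (ν - a) * (v + 1) ^ (-(ν + a - 1)) * (1 + Real.log (v + 1)) ^ (-r)) := by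
  have hP : v + 1 ≤ (u + 1) * (v + 1) := by nlinarith [mul_pos hu hv]
  have hP1 : 1 ≤ (u + 1) * (v + 1) := by linarith
  have hSP : u * v ≤ (u + 1) * (v + 1) := by nlinarith
  have hlv : 0 < Real.log (v + 1) := Real.log_pos (by linarith)
  have hlP : Real.log (v + 1) ≤ Real.log ((u + 1) * (v + 1)) := Real.log_le_log (by linarith) hP
  have hmul : (u ^ (ν - a) * (u + 1) ^ (-(ν + a - 1))) *
      (v ^ (ν - a) * (v + 1) ^ (-(ν + a - 1)) * (1 + Real.log (v + 1)) ^ (-r)) =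
      (1 + Real.log (v + 1)) ^ (-r) * ((u + 1) * (v + 1)) ^ (-(ν + a - 1)) *
        (u * v) ^ (ν - a) := by
    rw [Real.mul_rpow hu.le hv.le, Real.mul_rpow (by linarith) (by linarith)]; ring
  rw [hmul]
  set P := (u + 1) * (v + 1)
  set S := u * v
  have hS : 0 < S := mul_pos hu hv
  have hP0 : 0 < P := by linarith
  have hlP0 : 0 < Real.log P := hlv.trans_le hlP
  have hr' : ν + a - 1 ≤ (a - 1) * r := by
    rw [div_le_iff₀ (by linarith)] at hr; linarith
  have e1 : S ^ (ν + p * r - a) = S ^ (p * r) * S ^ (ν - a) := by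
    rw [← Real.rpow_add hS]; congr 1; ring
  have e2 : (P ^ (1 - a - p)) ^ r = P ^ (-((a - 1) * r)) * P ^ (-(p * r)) := by
    rw [← Real.rpow_mul hP0.le, ← Real.rpow_add hP0]; congr 1; ring
  have e3 : P ^ (-(p * r)) * P ^ (p * r) = 1 := by
    rw [← Real.rpow_add hP0]; simp
  rw [Real.mul_rpow (by positivity) (by positivity), e1, e2, ← Real.rpow_neg_one (1 + Real.log P),
    ← Real.rpow_mul (by linarith), neg_one_mul]
  calc _ ≤ (1 + Real.log (v + 1)) ^ (-r) * (P ^ (-(ν + a - 1)) * P ^ (-(p * r))) *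
        (P ^ (p * r) * S ^ (ν - a)) := by
        gcongr ?_ * (?_ * _) * (?_ * _)
        · exact Real.rpow_le_rpow_of_nonpos (by linarith) (by linarith) (by linarith)
        · exact Real.rpow_le_rpow_of_exponent_le hP1 (by linarith)
        · exact Real.rpow_le_rpow hS.le hSP (by positivity)
    _ = (1 + Real.log (v + 1)) ^ (-r) * P ^ (-(ν + a - 1)) *
        (P ^ (-(p * r)) * P ^ (p * r)) * S ^ (ν - a) := by ring
    _ = _ := by rw [e3, mul_one]

lemma lintegral_rpow_mul_rpow_lt_top {b d : ℝ} (hb : -1 < b) (hd : 0 ≤ d) (hbd : b - d < -1) :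
    ∫⁻ u in Ioi (0 : ℝ), ENNReal.ofReal (u ^ b * (u + 1) ^ (-d)) < ∞ := by
  rw [← Ioc_union_Ioi_eq_Ioi zero_le_one]
  refine (lintegral_union_le _ _ _).trans_lt (ENNReal.add_lt_top.2 ⟨?_, ?_⟩)
  · have h := (intervalIntegral.intervalIntegrable_rpow' (a := 0) (b := 1) hb).1
    refine (setLIntegral_mono' measurableSet_Ioc fun u hu => ?_).trans_lt h.setLIntegral_lt_top
    refine ENNReal.ofReal_le_ofReal (mul_le_of_le_one_right (Real.rpow_nonneg hu.1.le _) ?_)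
    exact Real.rpow_le_one_of_one_le_of_nonpos (by linarith [hu.1]) (neg_nonpos.2 hd)
  · have h := integrableOn_Ioi_rpow_of_lt hbd zero_lt_one
    refine (setLIntegral_mono' measurableSet_Ioi fun u hu => ?_).trans_lt h.setLIntegral_lt_top
    have hu1 : 1 < u := hu
    refine ENNReal.ofReal_le_ofReal ?_
    rw [sub_eq_add_neg, Real.rpow_add (by linarith)]
    gcongr ?_ * ?_
    exact Real.rpow_le_rpow_of_nonpos (by linarith) (by linarith) (by linarith)

lemma integrableOn_inv_mul_log_rpow {r : ℝ} (hr : 1 < r) :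
    IntegrableOn (fun v : ℝ => (v + 1)⁻¹ * (1 + Real.log (v + 1)) ^ (-r)) (Ioi 0) := by
  refine integrableOn_Ioi_deriv_of_nonneg' (l := 0)
    (g := fun v => (1 + Real.log (v + 1)) ^ (-(r - 1)) * (-(r - 1))⁻¹) ?_ ?_ ?_
  · intro v hv
    have hv0 : 0 ≤ v := hv
    have hl : 0 ≤ Real.log (v + 1) := Real.log_nonneg (by linarith)
    have h1 : HasDerivAt (fun v : ℝ => 1 + Real.log (v + 1)) ((v + 1)⁻¹) v := by
      simpa using (((hasDerivAt_id v).add_const 1).log (by simp; linarith)).const_add 1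
    refine ((h1.rpow_const (p := -(r - 1)) (Or.inl (by positivity))).mul_const _).congr_deriv ?_
    rw [show -(r - 1) - 1 = -r by ring]
    have hne : r - 1 ≠ 0 := by linarith
    field_simp
  · intro v hv
    have hv0 : 0 < v := hv
    have hl : 0 ≤ Real.log (v + 1) := Real.log_nonneg (by linarith)
    positivity
  · rw [← zero_mul (-(r - 1))⁻¹]
    refine Filter.Tendsto.mul_const _ ((tendsto_rpow_neg_atTop (by linarith)).comp ?_)
    exact Filter.tendsto_atTop_add_const_left _ _
      (Real.tendsto_log_atTop.comp (Filter.tendsto_atTop_add_const_right _ _ Filter.tendsto_id))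

lemma lintegral_inv_mul_inv_log {C : ℝ} (hC : 0 ≤ C) :
    ∫⁻ v in Ioi (4 : ℝ), ENNReal.ofReal (v⁻¹ * (C + Real.log v)⁻¹) = ∞ := by
  by_contra h
  have hnn : ∀ v ∈ Ioi (4 : ℝ), 0 ≤ v⁻¹ * (C + Real.log v)⁻¹ := by
    intro v hv
    have hv4 : 4 < v := hv
    have := Real.log_nonneg (show 1 ≤ v by linarith)
    positivity
  rw [← Ne, lintegral_ofReal_ne_top_iff_integrable (by fun_prop)
    ((ae_restrict_iff' measurableSet_Ioi).2 (Filter.Eventually.of_forall hnn))] at h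
  have hd : ∀ v : ℝ, 4 < v → HasDerivAt (fun v => Real.log (C + Real.log v))
      (v⁻¹ * (C + Real.log v)⁻¹) v := by
    intro v hv
    have hlog := Real.log_pos (show 1 < v by linarith)
    refine (((Real.hasDerivAt_log (by linarith)).const_add C).log (by positivity)).congr_deriv ?_
    rw [div_eq_mul_inv]
  have hev : ∀ᶠ v : ℝ in Filter.atTop, 4 < v := Filter.eventually_gt_atTop 4
  refine not_integrableOn_of_tendsto_norm_atTop_of_deriv_isBigO_filter
    (f := fun v => Real.log (C + Real.log v)) Filter.atTop (Filter.Ioi_mem_atTop 4)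
    (hev.mono fun v hv => (hd v hv).differentiableAt) ?_ ?_ h
  · exact tendsto_norm_atTop_atTop.comp (Real.tendsto_log_atTop.comp
      (Filter.tendsto_atTop_add_const_left _ _ Real.tendsto_log_atTop))
  · exact Filter.EventuallyEq.isBigO (hev.mono fun v hv => (hd v hv).deriv)

lemma lintegral_lightCone_integrand_lt_top (n : ℕ) [NeZero n] (hn : 3 ≤ n) {ν p r : ℝ}
    (hν : (n : ℝ) / 2 - 1 < ν) (hp : 1 ≤ p) (hr : qnu n ν ≤ r) :
    ∫⁻ y in lightCone n, ENNReal.ofReal (((1 + Real.log (lorentzQ n (y + eVec n)))⁻¹ *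
      lorentzQ n (y + eVec n) ^ (1 - (n : ℝ) / 2 - p)) ^ r *
        lorentzQ n y ^ (ν + p * r - (n : ℝ) / 2)) < ∞ := by
  have hn3 : (3 : ℝ) ≤ n := by exact_mod_cast hn
  have hr1 : 1 < r := by
    refine lt_of_lt_of_le ?_ hr
    rw [qnu, lt_div_iff₀ (by linarith)]; linarith
  set a : ℝ := (n : ℝ) / 2 with ha
  set G₀ : ℝ → ℝ≥0∞ := (Ioi 0).indicator fun v => ENNReal.ofReal
    (v ^ (ν - a) * (v + 1) ^ (-(ν + a - 1)) * (1 + Real.log (v + 1)) ^ (-r)) with hG₀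
  set G : ℝ → ℝ≥0∞ := fun v => ENNReal.ofReal (v ^ (n - 2)) * G₀ v with hG
  set H : ℝ → ℝ≥0∞ := (Ioi 0).indicator fun u => ENNReal.ofReal
    (u ^ (ν - a) * (u + 1) ^ (-(ν + a - 1))) with hH
  have hmG₀ : Measurable G₀ := Measurable.indicator (by fun_prop) measurableSet_Ioi
  have hmG : Measurable G := by fun_prop
  have hmH : Measurable H := Measurable.indicator (by fun_prop) measurableSet_Ioi
  obtain ⟨c, -, hc, hg⟩ := lintegral_axial n (by omega)
  have h1 : ∫⁻ y in lightCone n, ENNReal.ofReal (((1 + Real.log (lorentzQ n (y + eVec n)))⁻¹ *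
      lorentzQ n (y + eVec n) ^ (1 - a - p)) ^ r * lorentzQ n y ^ (ν + p * r - a)) ≤
      ∫⁻ y, G₀ (y 0 + spatialNorm n y) * H (y 0 - spatialNorm n y) := by
    have hms := measurable_spatialNorm n
    have hm : Measurable fun y => G₀ (y 0 + spatialNorm n y) * H (y 0 - spatialNorm n y) :=
      (hmG₀.comp ((measurable_pi_apply 0).add hms)).mul
        (hmH.comp ((measurable_pi_apply 0).sub hms))
    refine (setLIntegral_mono hm fun y hy => ?_).trans (setLIntegral_le_lintegral _ _)
    have hρ := spatialNorm_nonneg n y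
    have hu : 0 < y 0 - spatialNorm n y := sub_pos.2 ((mem_lightCone_iff n y).1 hy)
    have hv : 0 < y 0 + spatialNorm n y := by linarith
    have hQ : lorentzQ n y = (y 0 - spatialNorm n y) * (y 0 + spatialNorm n y) := by
      rw [lorentzQ_eq]; ring
    have hQ' : lorentzQ n (y + eVec n) =
        (y 0 - spatialNorm n y + 1) * (y 0 + spatialNorm n y + 1) := by
      rw [lorentzQ_add, lorentzB_comm, lorentzB_eVec, lorentzQ_eVec, hQ]; ring
    rw [hG₀, hH, indicator_of_mem (mem_Ioi.2 hv), indicator_of_mem (mem_Ioi.2 hu), hQ, hQ',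
      mul_comm (ENNReal.ofReal _), ← ENNReal.ofReal_mul (by positivity)]
    exact ENNReal.ofReal_le_ofReal
      (coneIntegrand_le (by linarith) (by linarith) hr (by linarith) hu hv)
  have h2 := hg (fun t ρ => G₀ (t + ρ) * H (t - ρ)) (by unfold Function.uncurry; fun_prop)
  have h3 : ∫⁻ t, ∫⁻ ρ in Ioi (0 : ℝ), ENNReal.ofReal (ρ ^ (n - 2)) *
      (G₀ (t + ρ) * H (t - ρ)) ≤ ∫⁻ t, ∫⁻ ρ, G (t + ρ) * H (t - ρ) := by
    refine lintegral_mono fun t => ?_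
    refine (setLIntegral_mono (by fun_prop) fun ρ hρ => ?_).trans (setLIntegral_le_lintegral _ _)
    have hρ0 : 0 < ρ := hρ
    by_cases hu : 0 < t - ρ
    · rw [← mul_assoc]
      gcongr ?_ * _
      simp only [hG]
      gcongr
      linarith
    · simp [hH, hu]
  have hGint : ∫⁻ v, G v < ∞ := by
    have : ∫⁻ v, G v = ∫⁻ v in Ioi (0 : ℝ), ENNReal.ofReal (v ^ (n - 2)) * ENNReal.ofReal
        (v ^ (ν - a) * (v + 1) ^ (-(ν + a - 1)) * (1 + Real.log (v + 1)) ^ (-r)) := by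
      rw [← lintegral_indicator measurableSet_Ioi]
      refine lintegral_congr fun v => ?_
      by_cases hv : v ∈ Ioi (0 : ℝ) <;> simp [hG, hG₀, hv]
    rw [this]
    refine (setLIntegral_mono' measurableSet_Ioi fun v hv => ?_).trans_lt
      (integrableOn_inv_mul_log_rpow hr1).setLIntegral_lt_top
    have hv0 : 0 < v := hv
    have hl : 0 < Real.log (v + 1) := Real.log_pos (by linarith)
    rw [← ENNReal.ofReal_mul (by positivity)]
    refine ENNReal.ofReal_le_ofReal ?_
    have e1 : v ^ (n - 2) * v ^ (ν - a) = v ^ (ν + a - 2) := by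
      rw [← Real.rpow_natCast, ← Real.rpow_add hv0, Nat.cast_sub (by omega)]
      congr 1; push_cast; rw [ha]; ring
    calc _ = v ^ (ν + a - 2) * (v + 1) ^ (-(ν + a - 1)) * (1 + Real.log (v + 1)) ^ (-r) := by
          rw [← e1]; ring
      _ ≤ (v + 1) ^ (ν + a - 2) * (v + 1) ^ (-(ν + a - 1)) * (1 + Real.log (v + 1)) ^ (-r) := by
          gcongr ?_ * _ * _
          exact Real.rpow_le_rpow hv0.le (by linarith) (by linarith)
      _ = _ := by
          rw [← Real.rpow_add (by linarith), ← Real.rpow_neg_one (v + 1)]; congr 2; ring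
  have hHint : ∫⁻ u, H u < ∞ := by
    rw [hH, lintegral_indicator measurableSet_Ioi]
    exact lintegral_rpow_mul_rpow_lt_top (by linarith) (by linarith) (by linarith)
  refine h1.trans_lt ?_
  rw [h2]
  refine ENNReal.mul_lt_top hc.lt_top (h3.trans_lt ?_)
  rw [lintegral_lightCone_coords hmG hmH]
  exact ENNReal.mul_lt_top (ENNReal.mul_lt_top ENNReal.ofReal_lt_top hGint) hHint

lemma lintegral_waveOp_Fex_lt_top (n : ℕ) [NeZero n] (hn : 3 ≤ n) {ν p q : ℝ}
    (hν : (n : ℝ) / 2 - 1 < ν) (hp : 1 ≤ p) (hq : p * qnu n ν ≤ q) :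
    ∫⁻ y in lightCone n,
      (∫⁻ x : Fin n → ℝ, (‖waveOp n (Fex n p) (tubePt n x y)‖₊ : ℝ≥0∞) ^ p) ^ (q / p) *
        ENNReal.ofReal (lorentzQ n y ^ (ν + q - (n : ℝ) / 2)) < ∞ := by
  have hp0 : 0 < p := by linarith
  have hn3 : (3 : ℝ) ≤ n := by exact_mod_cast hn
  have hr : qnu n ν ≤ q / p := by rw [le_div_iff₀ hp0]; linarith
  have hqnu : 0 < qnu n ν := div_pos (by linarith) (by linarith)
  have hr0 : 0 ≤ q / p := by linarith
  have hpr : p * (q / p) = q := by field_simp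
  obtain ⟨C, hC, hle⟩ := lintegral_waveOp_Fex_le n (by omega) hp
  have key := lintegral_lightCone_integrand_lt_top n hn hν hp hr
  rw [hpr] at key
  refine (setLIntegral_mono' (measurableSet_lightCone n) fun y hy => ?_).trans_lt
    ((lintegral_const_mul' (C ^ (q / p)) _ (ENNReal.rpow_ne_top_of_nonneg hr0 hC)).trans_lt
      (ENNReal.mul_lt_top (ENNReal.rpow_lt_top_of_nonneg hr0 hC) key))
  have hQ1 := add_eVec_mem hy
  have hlog := Real.log_pos hQ1
  rw [ENNReal.ofReal_mul (by positivity), ← ENNReal.ofReal_rpow_of_nonneg (by positivity) hr0,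
    ← mul_assoc, ← ENNReal.mul_rpow_of_nonneg _ _ hr0]
  gcongr
  exact hle y hy

lemma norm_one_add_log_le {w : ℂ} (hw : 1 < ‖w‖) :
    ‖1 + Complex.log w‖ ≤ 1 + Real.pi + Real.log ‖w‖ := by
  refine (Complex.norm_le_abs_re_add_abs_im _).trans ?_
  rw [one_add_log_re, abs_of_pos (by linarith [Real.log_pos hw])]
  have : |(1 + Complex.log w).im| ≤ Real.pi := by
    simpa [Complex.log_im] using Complex.abs_arg_le_pi w
  linarith

lemma le_norm_Fex_rpow (n : ℕ) [NeZero n] {p : ℝ} (hp : 1 ≤ p) {z : Fin n → ℂ}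
    (hz : inTube n z) :
    ‖shiftedQ n z‖ ^ (-((n : ℝ) - 1)) * (1 + Real.pi + Real.log ‖shiftedQ n z‖)⁻¹ ≤
      ‖Fex n p z‖ ^ p := by
  obtain ⟨-, hw⟩ := shiftedQ_mem hz
  have hp0 : 0 < p := by linarith
  rw [Fex_eq]
  simp only [powLog]
  rw [norm_mul, Complex.norm_cpow_real, Complex.norm_cpow_real,
    Real.mul_rpow (by positivity) (by positivity), ← Real.rpow_mul (norm_nonneg _),
    ← Real.rpow_mul (norm_nonneg _)]
  have e1 : -(((n : ℝ) - 1) / p) * p = -((n : ℝ) - 1) := by field_simp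
  have e2 : -(1 / p) * p = -1 := by field_simp
  rw [e1, e2, Real.rpow_neg_one]
  have h0 := one_add_log_le_norm (shiftedQ n z)
  have hl := Real.log_pos hw
  gcongr
  · linarith
  · exact norm_one_add_log_le hw

lemma rpow_lower_bound {n : ℕ} (hn : 2 ≤ n) {v u ρ : ℝ} (hv : 4 < v) (hu : u ∈ Icc (-1 : ℝ) 1)
    (hρ : v - u = 2 * ρ) :
    (4 ^ (n - 2) * 6 ^ (n - 1) : ℝ)⁻¹ * (v⁻¹ * (1 + Real.pi + Real.log 6 + Real.log v)⁻¹) ≤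
      ρ ^ (n - 2) * ((√((2 : ℝ) ^ 2 + v ^ 2) * √((2 : ℝ) ^ 2 + u ^ 2)) ^ (-((n : ℝ) - 1)) *
        (1 + Real.pi + Real.log (√((2 : ℝ) ^ 2 + v ^ 2) * √((2 : ℝ) ^ 2 + u ^ 2)))⁻¹) := by
  obtain ⟨m, rfl⟩ : ∃ m, n = m + 2 := ⟨n - 2, by omega⟩
  set A := √((2 : ℝ) ^ 2 + v ^ 2)
  set B := √((2 : ℝ) ^ 2 + u ^ 2)
  have hA1 : 1 ≤ A := Real.one_le_sqrt.2 (by nlinarith)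
  have hB1 : 1 ≤ B := Real.one_le_sqrt.2 (by nlinarith)
  have hA : A ≤ 2 * v := Real.sqrt_le_iff.2 ⟨by linarith, by nlinarith⟩
  have hB : B ≤ 3 := Real.sqrt_le_iff.2 ⟨by norm_num, by nlinarith [hu.1, hu.2]⟩
  have hM : A * B ≤ 6 * v := by nlinarith
  have hM1 : 1 ≤ A * B := by nlinarith
  have hρ4 : v / 4 ≤ ρ := by linarith [hu.2]
  have hlM : 0 ≤ Real.log (A * B) := Real.log_nonneg hM1
  have hlog : Real.log (A * B) ≤ Real.log 6 + Real.log v := by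
    rw [← Real.log_mul (by norm_num) (by linarith)]
    exact Real.log_le_log (by linarith) hM
  have hpi := Real.pi_pos
  have e1 : (-(((m + 2 : ℕ) : ℝ) - 1)) = -((m + 1 : ℕ) : ℝ) := by push_cast; ring
  rw [e1, Real.rpow_neg (by linarith), Real.rpow_natCast, Nat.add_sub_cancel,
    show m + 2 - 1 = m + 1 by omega]
  have hv0 : 0 < v := by linarith
  have hρ0 : 0 < ρ := by linarith
  have hl6 : 0 < Real.log 6 := Real.log_pos (by norm_num)
  have hlv : 0 < Real.log v := Real.log_pos (by linarith)
  calc _ = (v / 4) ^ m * (((6 * v) ^ (m + 1))⁻¹ *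
        (1 + Real.pi + (Real.log 6 + Real.log v))⁻¹) := by
        rw [← add_assoc, div_pow, mul_pow, pow_succ v]
        have : v ≠ 0 := by linarith
        field_simp
    _ ≤ _ := by gcongr

lemma lintegral_Fex_eq_top (n : ℕ) [NeZero n] (hn : 2 ≤ n) {p : ℝ} (hp : 1 ≤ p) :
    ∫⁻ x : Fin n → ℝ, (‖Fex n p (tubePt n x (eVec n))‖₊ : ℝ≥0∞) ^ p = ∞ := by
  have hp0 : 0 ≤ p := by linarith
  obtain ⟨c, hc0, -, hg⟩ := lintegral_axial n hn
  set M : ℝ → ℝ → ℝ := fun t ρ => √((2 : ℝ) ^ 2 + (t + ρ) ^ 2) * √((2 : ℝ) ^ 2 + (t - ρ) ^ 2)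
    with hM
  set g : ℝ → ℝ → ℝ≥0∞ := fun t ρ => ENNReal.ofReal
    (M t ρ ^ (-((n : ℝ) - 1)) * (1 + Real.pi + Real.log (M t ρ))⁻¹) with hgdef
  have hgm : Measurable (Function.uncurry g) := by
    simp only [hgdef, hM]; unfold Function.uncurry; fun_prop
  have h1 : ∫⁻ x : Fin n → ℝ, g (x 0) (spatialNorm n x) ≤
      ∫⁻ x : Fin n → ℝ, (‖Fex n p (tubePt n x (eVec n))‖₊ : ℝ≥0∞) ^ p := by
    refine lintegral_mono fun x => ?_
    have h := le_norm_Fex_rpow n hp (inTube_tubePt (x := x).2 (eVec_mem_lightCone n))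
    rw [shiftedQ_tubePt, show eVec n + eVec n = (2 : ℝ) • eVec n by rw [two_smul],
      norm_lorentzW_smul_eVec] at h
    rw [nnnorm_rpow_eq_ofReal _ hp0]
    exact ENNReal.ofReal_le_ofReal h
  rw [hg g hgm] at h1
  set k : ℝ := (4 ^ (n - 2) * 6 ^ (n - 1) : ℝ)⁻¹
  have hk : 0 < k := by positivity
  set G : ℝ → ℝ≥0∞ := (Ioi 4).indicator fun v => ENNReal.ofReal
    (k * (v⁻¹ * (1 + Real.pi + Real.log 6 + Real.log v)⁻¹)) with hG
  set H : ℝ → ℝ≥0∞ := (Icc (-1) 1).indicator fun _ => 1 with hH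
  have hmG : Measurable G := Measurable.indicator (by fun_prop) measurableSet_Ioi
  have hmH : Measurable H := Measurable.indicator (by fun_prop) measurableSet_Icc
  have hlow : ∫⁻ t, ∫⁻ ρ, G (t + ρ) * H (t - ρ) ≤
      ∫⁻ t, ∫⁻ ρ in Ioi (0 : ℝ), ENNReal.ofReal (ρ ^ (n - 2)) * g t ρ := by
    refine lintegral_mono fun t => ?_
    rw [← lintegral_indicator measurableSet_Ioi]
    refine lintegral_mono fun ρ => ?_
    by_cases hv : 4 < t + ρ
    · by_cases hu : t - ρ ∈ Icc (-1 : ℝ) 1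
      · have hρ : 0 < ρ := by linarith [hu.2]
        rw [hG, hH, indicator_of_mem (mem_Ioi.2 hv), indicator_of_mem hu,
          indicator_of_mem (mem_Ioi.2 hρ), mul_one, ← ENNReal.ofReal_mul (by positivity)]
        exact ENNReal.ofReal_le_ofReal (rpow_lower_bound hn hv hu (by ring))
      · rw [hH, indicator_of_notMem hu, mul_zero]; exact zero_le
    · rw [hG, indicator_of_notMem (by simpa using hv), zero_mul]; exact zero_le
  have hGint : ∫⁻ v, G v = ∞ := by
    rw [hG, lintegral_indicator measurableSet_Ioi]
    simp_rw [ENNReal.ofReal_mul hk.le]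
    rw [lintegral_const_mul' _ _ ENNReal.ofReal_ne_top, lintegral_inv_mul_inv_log
      (by have := Real.pi_pos; have := Real.log_nonneg (show (1 : ℝ) ≤ 6 by norm_num); linarith)]
    exact ENNReal.mul_top (by simpa using hk)
  have hHint : ∫⁻ u, H u = 2 := by
    rw [hH, lintegral_indicator measurableSet_Icc, setLIntegral_one, Real.volume_Icc]
    norm_num
  rw [lintegral_lightCone_coords hmG hmH, hGint, hHint, ENNReal.mul_top (by simp),
    ENNReal.top_mul (by simp), top_le_iff] at hlow
  rwa [hlow, ENNReal.mul_top hc0, top_le_iff] at h1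

/-- the function `F` above is holomorphic on the tube; its boundary
slice `F(·+ie)` is not in `L^p(ℝ^n)`, while for every `q ≥ p·q_ν` the mixed norm
`‖□F‖_{L^{p,q}_{ν+q}}` is finite. -/
theorem statement16 (n : ℕ) [NeZero n] (hn : 3 ≤ n) (ν p : ℝ)
    (hν : (n : ℝ) / 2 - 1 < ν) (hp : 1 ≤ p) :
    DifferentiableOn ℂ (Fex n p) {z : Fin n → ℂ | inTube n z} ∧
    (∫⁻ x : Fin n → ℝ, (‖Fex n p (tubePt n x (eVec n))‖₊ : ℝ≥0∞) ^ p) = ∞ ∧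
    (∀ q : ℝ, p * qnu n ν ≤ q →
      (∫⁻ y in lightCone n,
          (∫⁻ x : Fin n → ℝ, (‖waveOp n (Fex n p) (tubePt n x y)‖₊ : ℝ≥0∞) ^ p) ^ (q / p)
            * ENNReal.ofReal (lorentzQ n y ^ (ν + q - (n : ℝ) / 2))) < ∞) := by
  refine ⟨fun z hz => ?_, lintegral_Fex_eq_top n (by omega) hp,
    fun q hq => lintegral_waveOp_Fex_lt_top n hn hν hp hq⟩
  rw [Fex_eq]
  exact (differentiableAt_powLog_shiftedQ _ _ hz).differentiableWithinAt
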